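/- Let C be a simple cycle in a graph G that is 2-cell embedded on a closed surface X, and suppose C is non-separating (X ∖ C is connected). Then the graph G_C obtained by duplicating C (replacing each vertex v_i of C by a left copy v'_i and a right copy v''_i, with cycle edges duplicated on each side and each edge from C to G∖C attached to the copy on its side) is connected. -/

import Mathlib

/-! Topological model of closed orientable surfaces via polygon quotients,
graph embeddings, 2-cell embeddings, and the Euler–Poincaré formula. -/

/-- A point on the boundary of the unit disk: the point at parameter `t ∈ [0,1]`
along the `j`-th side of a regular `n`-gon inscribed in the unit circle. -/
noncomputable def polyPt (n j : ℕ) (t : ℝ) : ℂ :=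
  Complex.exp (Complex.I * Complex.ofReal (2 * Real.pi * ((j : ℝ) + t) / (n : ℝ)))

/-- The closed unit disk in the plane. -/
def Disk : Set ℂ := Metric.closedBall 0 1

/-- The boundary identification for the orientable genus-`k` surface, obtained from a
`4k`-gon with identification word `a₁b₁a₁⁻¹b₁⁻¹ ⋯ a_k b_k a_k⁻¹ b_k⁻¹`. -/
def orientRel (k : ℕ) (x y : ↥Disk) : Prop :=
  ∃ i < k, ∃ t ∈ Set.Icc (0 : ℝ) 1,
    (((x : ℂ) = polyPt (4 * k) (4 * i) t ∧ (y : ℂ) = polyPt (4 * k) (4 * i + 2) (1 - t)) ∨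
     ((x : ℂ) = polyPt (4 * k) (4 * i + 1) t ∧ (y : ℂ) = polyPt (4 * k) (4 * i + 3) (1 - t)))

/-- The orientable closed surface of genus `k`: the sphere for `k = 0`, and the quotient
of a `4k`-gon (here, the closed disk) by the standard identification word for `k ≥ 1`. -/
noncomputable def OrientSurface : ℕ → Type
  | 0 => Metric.sphere (0 : EuclideanSpace ℝ (Fin 3)) 1
  | (k + 1) => Quotient (Relation.EqvGen.setoid (orientRel (k + 1)))

noncomputable instance : ∀ k, TopologicalSpace (OrientSurface k)
  | 0 => inferInstanceAs (TopologicalSpace (Metric.sphere (0 : EuclideanSpace ℝ (Fin 3)) 1))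
  | (k + 1) =>
      inferInstanceAs (TopologicalSpace (Quotient (Relation.EqvGen.setoid (orientRel (k + 1)))))

/-- A topological embedding of a simple graph `G` in a topological space `X`:
vertices are mapped injectively to points, edges to arcs joining their endpoints,
arcs meet vertices only at their own endpoints, and two arcs carrying distinct
edges may intersect only in vertices (the non-crossing condition). -/
structure GraphEmbedding {V : Type} (G : SimpleGraph V) (X : Type) [TopologicalSpace X] where
  vmap : V → X
  vmap_inj : Function.Injective vmap
  arc : ∀ u v : V, G.Adj u v → C(↥(Set.Icc (0 : ℝ) 1), X)
  arc_zero : ∀ (u v : V) (h : G.Adj u v), arc u v h ⟨0, by norm_num⟩ = vmap u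
  arc_one : ∀ (u v : V) (h : G.Adj u v), arc u v h ⟨1, by norm_num⟩ = vmap v
  arc_inj : ∀ (u v : V) (h : G.Adj u v), Function.Injective (arc u v h)
  arc_symm : ∀ (u v : V) (h : G.Adj u v),
    Set.range (arc v u h.symm) = Set.range (arc u v h)
  arc_vertex : ∀ (u v : V) (h : G.Adj u v) (w : V),
    vmap w ∈ Set.range (arc u v h) → w = u ∨ w = v
  arc_disjoint : ∀ (u v : V) (h : G.Adj u v) (u' v' : V) (h' : G.Adj u' v'),
    s(u, v) ≠ s(u', v') →
    Set.range (arc u v h) ∩ Set.range (arc u' v' h') ⊆ Set.range vmap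

/-- The skeleton of an embedding: the set of points of `X` covered by vertices and arcs. -/
def GraphEmbedding.skeleton {V : Type} {G : SimpleGraph V} {X : Type} [TopologicalSpace X]
    (f : GraphEmbedding G X) : Set X :=
  Set.range f.vmap ∪ ⋃ (u : V) (v : V) (h : G.Adj u v), Set.range (f.arc u v h)

/-- The faces of an embedding: the connected components of the complement of the skeleton. -/
def GraphEmbedding.Faces {V : Type} {G : SimpleGraph V} {X : Type} [TopologicalSpace X]
    (f : GraphEmbedding G X) : Type :=
  ConnectedComponents ↥(f.skeletonᶜ)

/-- An embedding is a 2-cell embedding if every face is homeomorphic to an open disk. -/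
def GraphEmbedding.IsTwoCell {V : Type} {G : SimpleGraph V} {X : Type} [TopologicalSpace X]
    (f : GraphEmbedding G X) : Prop :=
  ∀ x : ↥(f.skeletonᶜ), Nonempty (↥(connectedComponent x) ≃ₜ ↥(Metric.ball (0 : ℂ) 1))


/-- A closed surface: a compact, path-connected Hausdorff space that is locally
homeomorphic to an open disk. -/
def IsClosedSurface (X : Type) [TopologicalSpace X] : Prop :=
  CompactSpace X ∧ PathConnectedSpace X ∧ T2Space X ∧
    ∀ x : X, ∃ U : Set X, IsOpen U ∧ x ∈ U ∧ Nonempty (↥U ≃ₜ ↥(Metric.ball (0 : ℂ) 1))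

/-- The graph `G_C` obtained from `G` by duplicating the simple (induced) cycle
`C = (c 0, …, c (p-1))`: each vertex `c i` is replaced by a left copy `(i, false)` and a
right copy `(i, true)`, the cycle edges are duplicated on each side, and each edge from
`c i` to a vertex `w` outside the cycle is attached to the copy on the side `side i w`. -/
def cycleDup {V : Type} (G : SimpleGraph V) (p : ℕ) (c : ZMod p → V)
    (side : ZMod p → V → Bool) :
    SimpleGraph ({v : V // v ∉ Set.range c} ⊕ (ZMod p × Bool)) :=
  SimpleGraph.fromRel fun x y =>
    (∃ (i : ZMod p) (b : Bool), x = Sum.inr (i, b) ∧ y = Sum.inr (i + 1, b)) ∨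
    (∃ (i : ZMod p) (w : {v : V // v ∉ Set.range c}), G.Adj (c i) w.1 ∧
      x = Sum.inr (i, side i w.1) ∧ y = Sum.inl w) ∨
    (∃ w w' : {v : V // v ∉ Set.range c}, G.Adj w.1 w'.1 ∧ x = Sum.inl w ∧ y = Sum.inl w')

/-- The point set of `X` covered by the embedded cycle `C`. -/
def cycleImage {V : Type} {G : SimpleGraph V} {X : Type} [TopologicalSpace X]
    (f : GraphEmbedding G X) (p : ℕ) (c : ZMod p → V)
    (hcyc : ∀ i : ZMod p, G.Adj (c i) (c (i + 1))) : Set X :=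
  ⋃ i : ZMod p, Set.range (f.arc (c i) (c (i + 1)) (hcyc i))

/-- The side function `side` is compatible with the embedding: the cycle has an annular
(two-sided) neighborhood `U ≃ S¹ × (-1,1)` in which it is the central circle, and for
every edge from `c i` to an outside vertex `w`, near `c i` the arc of that edge lies in
the side of the annulus prescribed by `side i w`. -/
def SideCompatible {V : Type} {G : SimpleGraph V} {X : Type} [TopologicalSpace X]
    (f : GraphEmbedding G X) (p : ℕ) (c : ZMod p → V)
    (hcyc : ∀ i : ZMod p, G.Adj (c i) (c (i + 1)))
    (side : ZMod p → V → Bool) : Prop :=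
  ∃ U : Set X, IsOpen U ∧ cycleImage f p c hcyc ⊆ U ∧
    ∃ e : ↥U ≃ₜ ↥(Metric.sphere (0 : ℂ) 1) × ↥(Set.Ioo (-1 : ℝ) 1),
      (∀ x : ↥U, (x : X) ∈ cycleImage f p c hcyc ↔ ((e x).2 : ℝ) = 0) ∧
      ∀ (i : ZMod p) (w : V) (hw : w ∉ Set.range c) (h : G.Adj (c i) w),
        ∃ ε > (0 : ℝ), ∀ t : ↥(Set.Icc (0 : ℝ) 1), 0 < (t : ℝ) → (t : ℝ) < ε →
          ∃ hm : f.arc (c i) w h t ∈ U,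
            (0 < ((e ⟨f.arc (c i) w h t, hm⟩).2 : ℝ) ↔ side i w = true)

lemma annulus_preconn (r : ℝ) : IsPreconnected {z : ℂ | r < ‖z‖ ∧ ‖z‖ < 1 ∧ 0 ≤ r} := by
  by_cases hr : 0 ≤ r
  · have h : {z : ℂ | r < ‖z‖ ∧ ‖z‖ < 1 ∧ 0 ≤ r} =
        (fun q : ℝ × ℝ => (q.1 : ℂ) * Complex.exp (q.2 * Complex.I)) ''
          (Set.Ioo r 1 ×ˢ Set.univ) := by
      ext z
      constructor
      · rintro ⟨h1, h2, -⟩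
        exact ⟨(‖z‖, Complex.arg z), ⟨⟨h1, h2⟩, trivial⟩, Complex.norm_mul_exp_arg_mul_I z⟩
      · rintro ⟨⟨a, b⟩, ⟨⟨h1, h2⟩, -⟩, rfl⟩
        simp only at h1 h2
        have ha : 0 ≤ a := hr.trans h1.le
        simp [Complex.norm_exp_ofReal_mul_I, abs_of_nonneg ha, h1, h2, hr]
    rw [h]
    apply IsPreconnected.image
    · exact isPreconnected_Ioo.prod isPreconnected_univ
    · fun_prop
  · simp [hr, isPreconnected_empty]

/-- One-endedness of a set homeomorphic to the open disc. -/
lemma disc_end {Y : Type} [TopologicalSpace Y] (φ : Y ≃ₜ ↥(Metric.ball (0 : ℂ) 1))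
    (K : Set Y) (hK : IsCompact K) :
    ∃ K' : Set Y, IsCompact K' ∧ K ⊆ K' ∧ IsPreconnected K'ᶜ := by
  have hc : IsCompact ((fun y => (φ y : ℂ)) '' K) := hK.image (by fun_prop)
  obtain ⟨r, hr0, hr1, hr⟩ : ∃ r : ℝ, 0 ≤ r ∧ r < 1 ∧ ∀ y ∈ K, ‖(φ y : ℂ)‖ ≤ r := by
    rcases K.eq_empty_or_nonempty with h | h
    · exact ⟨0, le_rfl, one_pos, by simp [h]⟩
    · obtain ⟨y, hy, hm⟩ := hK.exists_isMaxOn h (f := fun y => ‖(φ y : ℂ)‖)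
        (by fun_prop)
      refine ⟨‖(φ y : ℂ)‖, norm_nonneg _, ?_, fun z hz => hm hz⟩
      exact mem_ball_zero_iff.1 (φ y).2
  refine ⟨{y | ‖(φ y : ℂ)‖ ≤ r}, ?_, fun y hy => hr y hy, ?_⟩
  · have h1 : IsCompact {z : ↥(Metric.ball (0 : ℂ) 1) | ‖(z : ℂ)‖ ≤ r} := by
      rw [Subtype.isCompact_iff]
      convert isCompact_closedBall (0 : ℂ) r using 1
      ext z
      constructor
      · rintro ⟨w, hw, rfl⟩
        simpa using hw
      · intro hz
        have hz' : ‖z‖ ≤ r := by simpa using hz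
        exact ⟨⟨z, by simpa using hz'.trans_lt hr1⟩, hz', rfl⟩
    exact φ.isCompact_preimage.2 h1
  · have h1 : IsPreconnected {z : ↥(Metric.ball (0 : ℂ) 1) | r < ‖(z : ℂ)‖} := by
      rw [← Topology.IsInducing.subtypeVal.isPreconnected_image]
      convert annulus_preconn r using 1
      ext z
      constructor
      · rintro ⟨w, hw, rfl⟩
        exact ⟨hw, mem_ball_zero_iff.1 w.2, hr0⟩
      · rintro ⟨h1, h2, -⟩
        exact ⟨⟨z, by simpa using h2⟩, h1, rfl⟩
    have h2 := φ.isPreconnected_preimage.2 h1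
    convert h2 using 1
    ext y
    simp

lemma locConn {X : Type} [TopologicalSpace X] (hX : IsClosedSurface X) :
    LocallyConnectedSpace X := by
  obtain ⟨-, -, -, h⟩ := hX
  have hb : LocallyConnectedSpace ↥(Metric.ball (0 : ℂ) 1) :=
    Metric.isOpen_ball.locallyConnectedSpace
  rw [locallyConnectedSpace_iff_subsets_isOpen_isConnected]
  intro x N hN
  obtain ⟨U, hU, hxU, ⟨φ⟩⟩ := h x
  have hl : LocallyConnectedSpace U := φ.isOpenEmbedding.locallyConnectedSpace
  have hN' : (Subtype.val ⁻¹' N : Set U) ∈ nhds (⟨x, hxU⟩ : U) :=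
    continuous_subtype_val.continuousAt hN
  obtain ⟨V, hVN, hVo, hxV, hVc⟩ :=
    (locallyConnectedSpace_iff_subsets_isOpen_isConnected.1 hl) ⟨x, hxU⟩ _ hN'
  refine ⟨Subtype.val '' V, ?_, hU.isOpenEmbedding_subtypeVal.isOpenMap V hVo,
    ⟨_, hxV, rfl⟩, hVc.image _ continuous_subtype_val.continuousOn⟩
  rintro _ ⟨y, hy, rfl⟩
  exact hVN hy

/-- A connected set that meets `F` and leaves `F` meets `F` outside any compact part. -/
lemma meets_end {X : Type} [TopologicalSpace X] [T2Space X] {F K T : Set X} (hF : IsOpen F)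
    (hK : IsCompact K) (hKF : K ⊆ F) (hT : IsPreconnected T)
    {x y : X} (hx : x ∈ T) (hxF : x ∉ F) (hy : y ∈ T) (hyF : y ∈ F) :
    ∃ z ∈ T, z ∈ F ∧ z ∉ K := by
  by_contra! hcon
  obtain ⟨z, hz, hz1, hz2⟩ := hT F Kᶜ hF hK.isClosed.isOpen_compl
    (fun z hz => by
      by_cases h : z ∈ F
      · exact Or.inl h
      · exact Or.inr fun h' => h (hKF h')) ⟨y, hy, hyF⟩ ⟨x, hx, fun h => hxF (hKF h)⟩
  exact hz2 (hcon z hz hz1)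

/-- The topological core. -/
lemma topo_core {X : Type} [TopologicalSpace X] [CompactSpace X] [T2Space X]
    [LocallyConnectedSpace X] [PreconnectedSpace X]
    (S C SA SB NA NB : Set X) (hS : IsClosed S)
    (hball : ∀ x : ↥(Sᶜ), Nonempty (↥(connectedComponent x) ≃ₜ ↥(Metric.ball (0 : ℂ) 1)))
    (hSdec : S = C ∪ SA ∪ SB)
    (hNAo : IsOpen NA) (hNBo : IsOpen NB) (hN : Disjoint NA NB)
    (hNAC : Disjoint NA C) (hNBC : Disjoint NB C)
    (hNo : IsOpen (NA ∪ NB ∪ C)) (hSA : SA ⊆ NA) (hSB : SB ⊆ NB)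
    (hconn : IsPreconnected Cᶜ)
    (TA TB : Set X) (hTA : IsPreconnected TA) (hTB : IsPreconnected TB)
    (hTAs : TA ⊆ C ∪ NA) (hTBs : TB ⊆ C ∪ NB)
    (hTA1 : (TA ∩ C).Nonempty) (hTB1 : (TB ∩ C).Nonempty)
    (hTA2 : (TA ∩ NA).Nonempty) (hTB2 : (TB ∩ NB).Nonempty) : False := by
  let F : X → Set X := fun x => connectedComponentIn Sᶜ x
  have hFo : ∀ x, IsOpen (F x) := fun x => hS.isOpen_compl.connectedComponentIn
  have hFS : ∀ x, F x ⊆ Sᶜ := fun x => connectedComponentIn_subset _ _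
  have hCS : C ⊆ S := by rw [hSdec]; intro x hx; exact Or.inl (Or.inl hx)
  have hSN : S ⊆ NA ∪ NB ∪ C := by
    rw [hSdec]
    rintro x ((hx | hx) | hx)
    · exact Or.inr hx
    · exact Or.inl (Or.inl (hSA hx))
    · exact Or.inl (Or.inr (hSB hx))
  have hFcl : ∀ x, closure (F x) ⊆ F x ∪ S := by
    intro x y hy
    by_cases hyS : y ∈ S
    · exact Or.inr hyS
    · left
      obtain ⟨z, hz1, hz2⟩ := mem_closure_iff.1 hy (F y) (hFo y) (mem_connectedComponentIn hyS)
      have h1 : F y = F z := connectedComponentIn_eq hz1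
      have h2 : F x = F z := connectedComponentIn_eq hz2
      rw [h2, ← h1]
      exact mem_connectedComponentIn hyS
  have htype : ∀ x ∉ S, ∃ K : Set X, IsCompact K ∧ K ⊆ F x ∧
      (F x \ K ⊆ NA ∨ F x \ K ⊆ NB) := by
    intro x hx
    have hFx : F x = Subtype.val '' (connectedComponent (⟨x, hx⟩ : ↥(Sᶜ))) :=
      connectedComponentIn_eq_image hx
    obtain ⟨φ⟩ := hball ⟨x, hx⟩
    have hK0 : IsCompact (F x \ (NA ∪ NB ∪ C)) := by
      have : F x \ (NA ∪ NB ∪ C) = closure (F x) \ (NA ∪ NB ∪ C) := by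
        apply Set.Subset.antisymm
        · exact Set.sdiff_subset_sdiff_left subset_closure
        · rintro y ⟨hy, hyN⟩
          rcases hFcl x hy with h | h
          · exact ⟨h, hyN⟩
          · exact absurd (hSN h) hyN
      rw [this]
      exact (isClosed_closure.sdiff hNo).isCompact
    let ι : ↥(connectedComponent (⟨x, hx⟩ : ↥(Sᶜ))) → X := fun y => (y : ↥(Sᶜ))
    have hι : Topology.IsInducing ι :=
      Topology.IsInducing.subtypeVal.comp Topology.IsInducing.subtypeVal
    have hιr : Set.range ι = F x := by
      rw [hFx]; ext y; simp [ι]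
    have hK1 : IsCompact (ι ⁻¹' (F x \ (NA ∪ NB ∪ C))) := by
      rw [hι.isCompact_iff, Set.image_preimage_eq_of_subset]
      · exact hK0
      · rw [hιr]; exact Set.sdiff_subset
    obtain ⟨K', hK', hsub, hpre⟩ := disc_end φ _ hK1
    have hιinj : Function.Injective ι :=
      Subtype.val_injective.comp Subtype.val_injective
    have himg : ι '' K'ᶜ = F x \ ι '' K' := by
      rw [← hιr, ← Set.image_univ, ← Set.image_sdiff hιinj, Set.compl_eq_univ_sdiff K']
    have hp : IsPreconnected (F x \ ι '' K') := by
      rw [← himg]; exact hpre.image _ hι.continuous.continuousOn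
    refine ⟨ι '' K', hK'.image hι.continuous, ?_, ?_⟩
    · rw [← hιr]; exact Set.image_subset_range _ _
    · apply hp.subset_or_subset hNAo hNBo hN
      rintro y ⟨hy, hyK⟩
      by_contra hyN
      rw [← hιr] at hy
      obtain ⟨z, rfl⟩ := hy
      refine hyK ⟨z, hsub ⟨hιr ▸ ⟨z, rfl⟩, ?_⟩, rfl⟩
      rintro (h | h)
      · exact hyN h
      · exact hFS x (hιr ▸ ⟨z, rfl⟩) (hCS h)
  -- the general symmetric part
  have key : ∀ (S1 N1 N2 : Set X), IsOpen N1 → Disjoint N1 N2 → S1 ⊆ N1 → S1 ⊆ S →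
      (∀ x ∉ S, ∃ K : Set X, IsCompact K ∧ K ⊆ F x ∧ (F x \ K ⊆ N1 ∨ F x \ K ⊆ N2)) →
      (∀ (T : Set X), IsPreconnected T → T ⊆ S ∪ N1 → (T ∩ S).Nonempty → ∀ y ∈ T, y ∉ S →
        ∃ K : Set X, IsCompact K ∧ K ⊆ F y ∧ F y \ K ⊆ N1) := by
    intro S1 N1 N2 hN1 hdis hS1 hS1S hty T hT hTN hTS y hy hyS
    obtain ⟨K, hK, hKF, h | h⟩ := hty y hyS
    · exact ⟨K, hK, hKF, h⟩
    · exfalso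
      obtain ⟨x, hx, hxS⟩ := hTS
      obtain ⟨z, hz, hzF, hzK⟩ := meets_end (hFo y) hK hKF hT hx (fun h => hFS y h hxS) hy
        (mem_connectedComponentIn hyS)
      rcases hTN hz with h' | h'
      · exact hFS y hzF h'
      · exact Set.disjoint_left.1 hdis h' (h ⟨hzF, hzK⟩)
  let W : Set X → Set X → Set X := fun S1 N1 =>
    S1 ∪ {x | x ∉ S ∧ ∃ K : Set X, IsCompact K ∧ K ⊆ F x ∧ F x \ K ⊆ N1}
  have hWo : ∀ (S1 N1 N2 : Set X), IsOpen N1 → Disjoint N1 N2 → S1 ⊆ N1 → S1 ⊆ S →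
      (N1 ∩ S ⊆ S1) →
      (∀ x ∉ S, ∃ K : Set X, IsCompact K ∧ K ⊆ F x ∧ (F x \ K ⊆ N1 ∨ F x \ K ⊆ N2)) →
      IsOpen (W S1 N1) := by
    intro S1 N1 N2 hN1 hdis hS1 hS1S hNS hty
    rw [isOpen_iff_mem_nhds]
    rintro x (hx | ⟨hx, K, hK, hKF, hKN⟩)
    · obtain ⟨T, hTN, hTo, hxT, hTc⟩ :=
        (locallyConnectedSpace_iff_subsets_isOpen_isConnected.1 ‹_›) x N1 (hN1.mem_nhds (hS1 hx))
      refine Filter.mem_of_superset (hTo.mem_nhds hxT) fun y hy => ?_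
      by_cases hyS : y ∈ S
      · exact Or.inl (hNS ⟨hTN hy, hyS⟩)
      · exact Or.inr ⟨hyS, key S1 N1 N2 hN1 hdis hS1 hS1S hty T hTc.isPreconnected
          (fun z hz => Or.inr (hTN hz)) ⟨x, hxT, hS1S hx⟩ y hy hyS⟩
    · refine Filter.mem_of_superset ((hFo x).mem_nhds (mem_connectedComponentIn hx))
        fun y hy => Or.inr ⟨hFS x hy, K, hK, ?_⟩
      have : F x = F y := connectedComponentIn_eq hy
      rw [← this]
      exact ⟨hKF, hKN⟩
  have htype' : ∀ x ∉ S, ∃ K : Set X, IsCompact K ∧ K ⊆ F x ∧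
      (F x \ K ⊆ NB ∨ F x \ K ⊆ NA) := by
    intro x hx
    obtain ⟨K, h1, h2, h3⟩ := htype x hx
    exact ⟨K, h1, h2, h3.symm⟩
  have hSAS : SA ⊆ S := by rw [hSdec]; intro x hx; exact Or.inl (Or.inr hx)
  have hSBS : SB ⊆ S := by rw [hSdec]; intro x hx; exact Or.inr hx
  have hNAS : NA ∩ S ⊆ SA := by
    rintro x ⟨h1, h2⟩
    rw [hSdec] at h2
    rcases h2 with (h | h) | h
    · exact absurd h (Set.disjoint_left.1 hNAC h1)
    · exact h
    · exact absurd (hSB h) (Set.disjoint_left.1 hN h1)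
  have hNBS : NB ∩ S ⊆ SB := by
    rintro x ⟨h1, h2⟩
    rw [hSdec] at h2
    rcases h2 with (h | h) | h
    · exact absurd h (Set.disjoint_left.1 hNBC h1)
    · exact absurd h1 (Set.disjoint_left.1 hN (hSA h))
    · exact h
  have hne : ∀ (S1 N1 N2 T : Set X), IsOpen N1 → Disjoint N1 N2 → Disjoint N1 C →
      S1 ⊆ N1 → S1 ⊆ S → (N1 ∩ S ⊆ S1) →
      (∀ x ∉ S, ∃ K : Set X, IsCompact K ∧ K ⊆ F x ∧ (F x \ K ⊆ N1 ∨ F x \ K ⊆ N2)) →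
      IsPreconnected T → T ⊆ C ∪ N1 → (T ∩ C).Nonempty → (T ∩ N1).Nonempty →
      (Cᶜ ∩ W S1 N1).Nonempty := by
    intro S1 N1 N2 T hN1 hdis hdC hS1 hS1S hNS hty hT hTC hT1 hT2
    obtain ⟨y, hy, hyN⟩ := hT2
    refine ⟨y, Set.disjoint_left.1 hdC hyN, ?_⟩
    by_cases hyS : y ∈ S
    · exact Or.inl (hNS ⟨hyN, hyS⟩)
    · refine Or.inr ⟨hyS, key S1 N1 N2 hN1 hdis hS1 hS1S hty T hT
        (fun z hz => (hTC hz).imp_left fun h => hCS h) ?_ y hy hyS⟩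
      exact hT1.mono (Set.inter_subset_inter_right _ hCS)
  obtain ⟨x, hxC, hxA, hxB⟩ := hconn (W SA NA) (W SB NB)
    (hWo SA NA NB hNAo hN hSA hSAS hNAS htype)
    (hWo SB NB NA hNBo hN.symm hSB hSBS hNBS htype')
    (fun x hx => by
      by_cases hxS : x ∈ S
      · rw [hSdec] at hxS
        rcases hxS with (h | h) | h
        · exact absurd h hx
        · exact Or.inl (Or.inl h)
        · exact Or.inr (Or.inl h)
      · obtain ⟨K, h1, h2, h3 | h3⟩ := htype x hxS
        · exact Or.inl (Or.inr ⟨hxS, K, h1, h2, h3⟩)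
        · exact Or.inr (Or.inr ⟨hxS, K, h1, h2, h3⟩))
    (hne SA NA NB TA hNAo hN hNAC hSA hSAS hNAS htype hTA hTAs hTA1 hTA2)
    (hne SB NB NA TB hNBo hN.symm hNBC hSB hSBS hNBS htype' hTB hTBs hTB1 hTB2)
  rcases hxA with hA | ⟨hxS, K, hK, hKF, hKN⟩
  · rcases hxB with hB | ⟨hxS, -⟩
    · exact Set.disjoint_left.1 hN (hSA hA) (hSB hB)
    · exact hxS (hSAS hA)
  · rcases hxB with hB | ⟨-, K', hK', hKF', hKN'⟩
    · exact hxS (hSBS hB)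
    · obtain ⟨s, -, hs⟩ := hTA1
      obtain ⟨z, -, hz1, hz2⟩ := meets_end (hFo x) (hK.union hK') (Set.union_subset hKF hKF')
        isPreconnected_univ (Set.mem_univ s) (fun h => hFS x h (hCS hs)) (Set.mem_univ x)
        (mem_connectedComponentIn hxS)
      exact Set.disjoint_left.1 hN (hKN ⟨hz1, fun h => hz2 (Or.inl h)⟩)
        (hKN' ⟨hz1, fun h => hz2 (Or.inr h)⟩)

/-- The core in terms of a signed height function near `C`. -/
lemma height_core {X : Type} [TopologicalSpace X] [CompactSpace X] [T2Space X]
    [LocallyConnectedSpace X] [PreconnectedSpace X]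
    (S C QA QB : Set X) (h : X → ℝ)
    (hball : ∀ x : ↥(Sᶜ), Nonempty (↥(connectedComponent x) ≃ₜ ↥(Metric.ball (0 : ℂ) 1)))
    (hSdec : S = C ∪ QA ∪ QB)
    (hQA : IsClosed QA) (hQB : IsClosed QB) (hQ : QA ∩ QB ⊆ C)
    (hC : ∀ x, x ∈ C ↔ h x = 0)
    (hop : ∀ a b : ℝ, -1 ≤ a → b ≤ 1 → IsOpen (h ⁻¹' Set.Ioo a b))
    (hcl : ∀ a b : ℝ, -1 < a → b < 1 → IsClosed (h ⁻¹' Set.Icc a b))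
    (hTA : ∀ δ : ℝ, 0 < δ → δ < 1 → ∃ T : Set X, IsPreconnected T ∧ h '' T = Set.Ioc (-δ) 0)
    (hTB : ∀ δ : ℝ, 0 < δ → δ < 1 → ∃ T : Set X, IsPreconnected T ∧ h '' T = Set.Ico 0 δ)
    (hconn : IsPreconnected Cᶜ)
    (DA DB : Set X) (hDA : IsClosed DA) (hDB : IsClosed DB)
    (hDAC : Disjoint DA C) (hDBC : Disjoint DB C)
    (hQAD : ∀ x ∈ QA, x ∈ DA ∨ h x ≤ 0) (hQBD : ∀ x ∈ QB, x ∈ DB ∨ 0 ≤ h x) : False := by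
  have hCcl : IsClosed C := by
    convert hcl 0 0 (by norm_num) (by norm_num) using 1
    ext x; simp [hC]
  obtain ⟨δ, hδ0, hδ1, hδ⟩ : ∃ δ : ℝ, 0 < δ ∧ δ < 1 ∧
      ∀ x ∈ DA ∪ DB, ¬ (-δ ≤ h x ∧ h x ≤ δ) := by
    obtain ⟨n, hn⟩ := (hDA.union hDB).isCompact.elim_directed_cover
      (fun n : ℕ => (h ⁻¹' Set.Icc (-(1 / ((n : ℝ) + 2))) (1 / ((n : ℝ) + 2)))ᶜ)
      (fun n => by
        have h1 : 1 / ((n : ℝ) + 2) < 1 := by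
          rw [div_lt_one (by positivity)]; linarith [Nat.cast_nonneg (α := ℝ) n]
        exact (hcl _ _ (by linarith) h1).isOpen_compl)
      (fun x hx => by
        have hx0 : h x ≠ 0 := by
          rw [Ne, ← hC]
          rcases hx with hx | hx
          · exact Set.disjoint_left.1 hDAC hx
          · exact Set.disjoint_left.1 hDBC hx
        obtain ⟨n, hn⟩ := exists_nat_one_div_lt (abs_pos.2 hx0)
        refine Set.mem_iUnion.2 ⟨n, fun hm => ?_⟩
        have h1 : |h x| ≤ 1 / ((n : ℝ) + 2) := abs_le.2 hm
        have h2 : 1 / ((n : ℝ) + 2) ≤ 1 / ((n : ℝ) + 1) := by gcongr; norm_num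
        linarith)
      (by
        apply Monotone.directed_le
        intro m n hmn
        apply Set.compl_subset_compl.2
        apply Set.preimage_mono
        have : 1 / ((n : ℝ) + 2) ≤ 1 / ((m : ℝ) + 2) := by gcongr
        exact Set.Icc_subset_Icc (by linarith) this)
    refine ⟨1 / ((n : ℝ) + 2), by positivity, ?_, fun x hx => hn hx⟩
    rw [div_lt_one (by positivity)]; linarith [Nat.cast_nonneg (α := ℝ) n]
  have hA : ∀ x ∈ QA, -δ ≤ h x → h x ≤ δ → h x ≤ 0 := by
    intro x hx h1 h2
    rcases hQAD x hx with h3 | h3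
    · exact absurd ⟨h1, h2⟩ (hδ x (Or.inl h3))
    · exact h3
  have hB : ∀ x ∈ QB, -δ ≤ h x → h x ≤ δ → 0 ≤ h x := by
    intro x hx h1 h2
    rcases hQBD x hx with h3 | h3
    · exact absurd ⟨h1, h2⟩ (hδ x (Or.inr h3))
    · exact h3
  have hmid : IsOpen (h ⁻¹' Set.Ioo (-(δ / 2)) (δ / 2)) := hop _ _ (by linarith) (by linarith)
  obtain ⟨OA, OB, hOA, hOB, hAO, hBO, hOd⟩ := normal_separation
    (X := X) (s := (QA \ h ⁻¹' Set.Ioo (-(δ / 2)) (δ / 2)) ∪ h ⁻¹' Set.Icc (-(3 * δ / 4)) (-(δ / 4)))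
    (t := (QB \ h ⁻¹' Set.Ioo (-(δ / 2)) (δ / 2)) ∪ h ⁻¹' Set.Icc (δ / 4) (3 * δ / 4))
    ((hQA.sdiff hmid).union (hcl _ _ (by linarith) (by linarith)))
    ((hQB.sdiff hmid).union (hcl _ _ (by linarith) (by linarith)))
    (by
      rw [Set.disjoint_left]
      rintro x (⟨h1, h2⟩ | ⟨h1, h2⟩) (⟨h3, h4⟩ | ⟨h3, h4⟩)
      · have := (hC x).1 (hQ ⟨h1, h3⟩)
        exact h2 ⟨by linarith, by linarith⟩
      · linarith [hA x h1 (by linarith) (by linarith)]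
      · linarith [hB x h3 (by linarith) (by linarith)]
      · linarith)
  have hqc : IsClosed (h ⁻¹' Set.Icc (-(δ / 4)) (δ / 4)) := hcl _ _ (by linarith) (by linarith)
  have hpA : IsOpen (h ⁻¹' Set.Ioo (-(δ / 2)) 0) := hop _ _ (by linarith) (by linarith)
  have hpB : IsOpen (h ⁻¹' Set.Ioo 0 (δ / 2)) := hop _ _ (by linarith) (by linarith)
  obtain ⟨TA, hTA1, hTA2⟩ := hTA (δ / 2) (by linarith) (by linarith)
  obtain ⟨TB, hTB1, hTB2⟩ := hTB (δ / 2) (by linarith) (by linarith)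
  have hSdec' : S = C ∪ (QA \ C) ∪ (QB \ C) := by
    rw [hSdec]; ext x; simp only [Set.mem_union, Set.mem_diff]; tauto
  refine topo_core S C (QA \ C) (QB \ C)
    ((OA \ h ⁻¹' Set.Icc (-(δ / 4)) (δ / 4)) ∪ h ⁻¹' Set.Ioo (-(δ / 2)) 0)
    ((OB \ h ⁻¹' Set.Icc (-(δ / 4)) (δ / 4)) ∪ h ⁻¹' Set.Ioo 0 (δ / 2))
    (by rw [hSdec]; exact (hCcl.union hQA).union hQB) hball hSdec'
    ((hOA.sdiff hqc).union hpA) ((hOB.sdiff hqc).union hpB) ?_ ?_ ?_ ?_ ?_ ?_ hconn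
    TA TB hTA1 hTB1 ?_ ?_ ?_ ?_ ?_ ?_
  · rw [Set.disjoint_left]
    rintro x (⟨h1, h2⟩ | ⟨h1, h2⟩) (⟨h3, h4⟩ | ⟨h3, h4⟩)
    · exact Set.disjoint_left.1 hOd h1 h3
    · have : x ∈ OB := hBO (Or.inr ⟨by
        by_contra h5
        exact h2 ⟨by linarith, by linarith⟩, by linarith⟩)
      exact Set.disjoint_left.1 hOd h1 this
    · have : x ∈ OA := hAO (Or.inr ⟨by linarith, by
        by_contra h5
        exact h4 ⟨by linarith, by linarith⟩⟩)
      exact Set.disjoint_left.1 hOd this h3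
    · linarith
  · rw [Set.disjoint_left]
    rintro x (⟨h1, h2⟩ | ⟨h1, h2⟩) h3 <;> rw [hC] at h3
    · exact h2 ⟨by linarith, by linarith⟩
    · linarith
  · rw [Set.disjoint_left]
    rintro x (⟨h1, h2⟩ | ⟨h1, h2⟩) h3 <;> rw [hC] at h3
    · exact h2 ⟨by linarith, by linarith⟩
    · linarith
  · convert ((hOA.sdiff hqc).union (hOB.sdiff hqc)).union hmid using 1
    ext x
    have h3 : h x ∈ Set.Ioo (-(δ / 2)) (δ / 2) ↔
        h x ∈ Set.Ioo (-(δ / 2)) 0 ∨ h x ∈ Set.Ioo 0 (δ / 2) ∨ h x = 0 := by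
      constructor
      · rintro ⟨h1, h2⟩
        rcases lt_trichotomy (h x) 0 with h0 | h0 | h0
        · exact Or.inl ⟨h1, h0⟩
        · exact Or.inr (Or.inr h0)
        · exact Or.inr (Or.inl ⟨h0, h2⟩)
      · rintro (⟨h1, h2⟩ | ⟨h1, h2⟩ | h1)
        · exact ⟨h1, by linarith⟩
        · exact ⟨by linarith, h2⟩
        · exact ⟨by linarith, by linarith⟩
    simp only [Set.mem_union, Set.mem_diff, Set.mem_preimage, hC, h3]
    tauto
  · rintro x ⟨h1, h2⟩
    rw [hC] at h2
    by_cases h3 : h x ∈ Set.Ioo (-(δ / 2)) (δ / 2)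
    · exact Or.inr ⟨h3.1, lt_of_le_of_ne (hA x h1 (by linarith [h3.1]) (by linarith [h3.2])) h2⟩
    · exact Or.inl ⟨hAO (Or.inl ⟨h1, h3⟩), fun h4 => h3 ⟨by linarith [h4.1], by linarith [h4.2]⟩⟩
  · rintro x ⟨h1, h2⟩
    rw [hC] at h2
    by_cases h3 : h x ∈ Set.Ioo (-(δ / 2)) (δ / 2)
    · exact Or.inr ⟨lt_of_le_of_ne (hB x h1 (by linarith [h3.1]) (by linarith [h3.2])) (Ne.symm h2),
        h3.2⟩
    · exact Or.inl ⟨hBO (Or.inl ⟨h1, h3⟩), fun h4 => h3 ⟨by linarith [h4.1], by linarith [h4.2]⟩⟩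
  · intro x hx
    have h1 : h x ∈ Set.Ioc (-(δ / 2)) 0 := hTA2 ▸ ⟨x, hx, rfl⟩
    rcases h1.2.lt_or_eq with h2 | h2
    · exact Or.inr (Or.inr ⟨h1.1, h2⟩)
    · exact Or.inl ((hC x).2 h2)
  · intro x hx
    have h1 : h x ∈ Set.Ico 0 (δ / 2) := hTB2 ▸ ⟨x, hx, rfl⟩
    rcases h1.1.lt_or_eq with h2 | h2
    · exact Or.inr (Or.inr ⟨h2, h1.2⟩)
    · exact Or.inl ((hC x).2 h2.symm)
  · have h1 : (0 : ℝ) ∈ h '' TA := hTA2 ▸ ⟨by linarith, le_rfl⟩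
    obtain ⟨x, hx, h2⟩ := h1
    exact ⟨x, hx, (hC x).2 h2⟩
  · have h1 : (0 : ℝ) ∈ h '' TB := hTB2 ▸ ⟨le_rfl, by linarith⟩
    obtain ⟨x, hx, h2⟩ := h1
    exact ⟨x, hx, (hC x).2 h2⟩
  · have h1 : -(δ / 4) ∈ h '' TA := hTA2 ▸ ⟨by linarith, by linarith⟩
    obtain ⟨x, hx, h2⟩ := h1
    exact ⟨x, hx, Or.inr ⟨by linarith, by linarith⟩⟩
  · have h1 : δ / 4 ∈ h '' TB := hTB2 ▸ ⟨by linarith, by linarith⟩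
    obtain ⟨x, hx, h2⟩ := h1
    exact ⟨x, hx, Or.inr ⟨by linarith, by linarith⟩⟩

/-- Signed height near the cycle. -/
noncomputable def heightFn {X : Type} [TopologicalSpace X] (U : Set X)
    (e : ↥U ≃ₜ ↥(Metric.sphere (0 : ℂ) 1) × ↥(Set.Ioo (-1 : ℝ) 1)) (x : X) : ℝ :=
  open Classical in if hx : x ∈ U then ((e ⟨x, hx⟩).2 : ℝ) else 2

lemma heightFn_mem {X : Type} [TopologicalSpace X] (U : Set X)
    (e : ↥U ≃ₜ ↥(Metric.sphere (0 : ℂ) 1) × ↥(Set.Ioo (-1 : ℝ) 1)) (x : ↥U) :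
    heightFn U e x = ((e x).2 : ℝ) := by
  simp [heightFn]

lemma heightFn_preimage {X : Type} [TopologicalSpace X] (U : Set X)
    (e : ↥U ≃ₜ ↥(Metric.sphere (0 : ℂ) 1) × ↥(Set.Ioo (-1 : ℝ) 1)) (I : Set ℝ)
    (hI : (2 : ℝ) ∉ I) :
    heightFn U e ⁻¹' I = Subtype.val '' (e ⁻¹' {q | (q.2 : ℝ) ∈ I}) := by
  ext x
  constructor
  · intro hx
    by_cases hU : x ∈ U
    · refine ⟨⟨x, hU⟩, ?_, rfl⟩
      rw [Set.mem_preimage] at hx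
      rw [heightFn_mem U e ⟨x, hU⟩] at hx
      exact hx
    · simp [heightFn, hU, hI] at hx
  · rintro ⟨y, hy, rfl⟩
    rw [Set.mem_preimage, heightFn_mem]
    exact hy

lemma heightFn_open {X : Type} [TopologicalSpace X] (U : Set X) (hU : IsOpen U)
    (e : ↥U ≃ₜ ↥(Metric.sphere (0 : ℂ) 1) × ↥(Set.Ioo (-1 : ℝ) 1)) (a b : ℝ) (hb : b ≤ 1) :
    IsOpen (heightFn U e ⁻¹' Set.Ioo a b) := by
  rw [heightFn_preimage U e _ (fun h => by linarith [h.2])]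
  apply hU.isOpenEmbedding_subtypeVal.isOpenMap
  apply IsOpen.preimage e.continuous
  exact isOpen_Ioo.preimage (by fun_prop : Continuous fun q :
    ↥(Metric.sphere (0 : ℂ) 1) × ↥(Set.Ioo (-1 : ℝ) 1) => (q.2 : ℝ))

lemma heightFn_closed {X : Type} [TopologicalSpace X] [T2Space X] (U : Set X)
    (e : ↥U ≃ₜ ↥(Metric.sphere (0 : ℂ) 1) × ↥(Set.Ioo (-1 : ℝ) 1)) (a b : ℝ) (ha : -1 < a)
    (hb : b < 1) : IsClosed (heightFn U e ⁻¹' Set.Icc a b) := by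
  rw [heightFn_preimage U e _ (fun h => by linarith [h.2])]
  apply IsCompact.isClosed
  apply IsCompact.image _ continuous_subtype_val
  rw [e.isCompact_preimage]
  have h1 : IsCompact (Subtype.val ⁻¹' Set.Icc a b : Set ↥(Set.Ioo (-1 : ℝ) 1)) := by
    rw [Subtype.isCompact_iff, Set.image_preimage_eq_of_subset]
    · exact isCompact_Icc
    · rw [Subtype.range_coe]
      exact fun x hx => ⟨by linarith [hx.1], by linarith [hx.2]⟩
  have h2 : IsCompact (Set.univ : Set ↥(Metric.sphere (0 : ℂ) 1)) :=
    isCompact_iff_isCompact_univ.1 (isCompact_sphere (0 : ℂ) 1)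
  convert h2.prod h1 using 1
  ext q
  simp

lemma heightFn_fiber {X : Type} [TopologicalSpace X] (U : Set X)
    (e : ↥U ≃ₜ ↥(Metric.sphere (0 : ℂ) 1) × ↥(Set.Ioo (-1 : ℝ) 1)) (I : Set ℝ)
    (hI : IsPreconnected I) (hI1 : I ⊆ Set.Ioo (-1) 1) :
    ∃ T : Set X, IsPreconnected T ∧ heightFn U e '' T = I := by
  let θ : ↥(Metric.sphere (0 : ℂ) 1) := ⟨1, by simp⟩
  refine ⟨(fun s : ↥(Set.Ioo (-1 : ℝ) 1) => (e.symm (θ, s) : X)) '' (Subtype.val ⁻¹' I), ?_, ?_⟩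
  · apply IsPreconnected.image
    · rw [← Topology.IsInducing.subtypeVal.isPreconnected_image,
        Set.image_preimage_eq_of_subset (by rwa [Subtype.range_coe])]
      exact hI
    · fun_prop
  · ext s
    constructor
    · rintro ⟨_, ⟨t, ht, rfl⟩, rfl⟩
      rw [heightFn_mem]
      simpa using ht
    · intro hs
      refine ⟨_, ⟨⟨s, hI1 hs⟩, hs, rfl⟩, ?_⟩
      rw [heightFn_mem]
      simp

section graphpart

variable {V : Type} {G : SimpleGraph V} {p : ℕ} {c : ZMod p → V} {side : ZMod p → V → Bool}

lemma dup_cyc (hp : 3 ≤ p) (i : ZMod p) (b : Bool) :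
    (cycleDup G p c side).Adj (Sum.inr (i, b)) (Sum.inr (i + 1, b)) := by
  haveI : Fact (1 < p) := ⟨by omega⟩
  rw [cycleDup, SimpleGraph.fromRel_adj]
  refine ⟨?_, Or.inl (Or.inl ⟨i, b, rfl, rfl⟩)⟩
  simp

lemma dup_side (i : ZMod p) (w : V) (hw : w ∉ Set.range c) (h : G.Adj (c i) w) :
    (cycleDup G p c side).Adj (Sum.inr (i, side i w)) (Sum.inl ⟨w, hw⟩) := by
  rw [cycleDup, SimpleGraph.fromRel_adj]
  exact ⟨by simp, Or.inl (Or.inr (Or.inl ⟨i, ⟨w, hw⟩, h, rfl, rfl⟩))⟩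

lemma dup_out (u w : V) (hu : u ∉ Set.range c) (hw : w ∉ Set.range c) (h : G.Adj u w) :
    (cycleDup G p c side).Adj (Sum.inl ⟨u, hu⟩) (Sum.inl ⟨w, hw⟩) := by
  rw [cycleDup, SimpleGraph.fromRel_adj]
  exact ⟨by simpa using h.ne, Or.inl (Or.inr (Or.inr ⟨⟨u, hu⟩, ⟨w, hw⟩, h, rfl, rfl⟩))⟩

lemma dup_cyc_reach (hp : 3 ≤ p) (i : ZMod p) (b : Bool) :
    (cycleDup G p c side).Reachable (Sum.inr (0, b)) (Sum.inr (i, b)) := by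
  haveI : NeZero p := ⟨by omega⟩
  have h : ∀ n : ℕ, (cycleDup G p c side).Reachable (Sum.inr (0, b)) (Sum.inr ((n : ZMod p), b)) := by
    intro n
    induction n with
    | zero => simp
    | succ n ih =>
      rw [Nat.cast_succ]
      exact ih.trans (dup_cyc hp _ b).reachable
  have := h i.val
  rwa [ZMod.natCast_zmod_val] at this

lemma dup_conn (hp : 3 ≤ p) (hG : G.Connected)
    (h : (cycleDup G p c side).Reachable (Sum.inr (0, false)) (Sum.inr (0, true))) :
    (cycleDup G p c side).Connected := by
  have hr : ∀ i b, (cycleDup G p c side).Reachable (Sum.inr (0, false)) (Sum.inr (i, b)) := by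
    intro i b
    cases b
    · exact dup_cyc_reach hp i false
    · exact h.trans (dup_cyc_reach hp i true)
  have hl : ∀ w v : V, G.Walk w v → v = c 0 → ∀ hw : w ∉ Set.range c,
      (cycleDup G p c side).Reachable (Sum.inr (0, false)) (Sum.inl ⟨w, hw⟩) := by
    intro w v q
    induction q with
    | nil => intro h1 hw; exact absurd ⟨0, h1.symm⟩ hw
    | @cons a b _ hab q ih =>
      intro h1 ha
      by_cases hb : b ∈ Set.range c
      · obtain ⟨i, rfl⟩ := hb
        exact (hr i (side i a)).trans (dup_side i a ha hab.symm).reachable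
      · exact (ih h1 hb).trans (dup_out b a hb ha hab.symm).reachable
  rw [SimpleGraph.connected_iff_exists_forall_reachable]
  refine ⟨Sum.inr (0, false), ?_⟩
  rintro (⟨w, hw⟩ | ⟨i, b⟩)
  · obtain ⟨q⟩ := hG.preconnected w (c 0)
    exact hl w _ q rfl hw
  · exact hr i b

variable {X : Type} [TopologicalSpace X]

lemma vmap_mem_cycle (f : GraphEmbedding G X) (hcyc : ∀ i : ZMod p, G.Adj (c i) (c (i + 1)))
    (v : V) (hv : v ∈ Set.range c) : f.vmap v ∈ cycleImage f p c hcyc := by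
  obtain ⟨i, rfl⟩ := hv
  exact Set.mem_iUnion.2 ⟨i, _, f.arc_zero _ _ _⟩

/-- An arc with an end outside of the cycle meets the cycle only in its end vertices. -/
lemma arc_inter_cycle (f : GraphEmbedding G X) (hcyc : ∀ i : ZMod p, G.Adj (c i) (c (i + 1)))
    (u v : V) (h : G.Adj u v) (huv : u ∉ Set.range c ∨ v ∉ Set.range c) (x : X)
    (hx : x ∈ Set.range (f.arc u v h))
    (hxC : x ∈ cycleImage f p c hcyc) : ∃ w ∈ Set.range c, (w = u ∨ w = v) ∧ x = f.vmap w := by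
  obtain ⟨i, hi⟩ := Set.mem_iUnion.1 hxC
  have hne : s(u, v) ≠ s(c i, c (i + 1)) := by
    intro he
    rw [Sym2.eq_iff] at he
    rcases he with ⟨rfl, rfl⟩ | ⟨rfl, rfl⟩ <;> simp at huv
  obtain ⟨w, rfl⟩ := f.arc_disjoint _ _ h _ _ (hcyc i) hne ⟨hx, hi⟩
  refine ⟨w, ?_, f.arc_vertex _ _ h w hx, rfl⟩
  rcases f.arc_vertex _ _ _ w hi with rfl | rfl <;> simp

lemma arc_piece [T2Space X] (f : GraphEmbedding G X)
    (hcyc : ∀ i : ZMod p, G.Adj (c i) (c (i + 1)))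
    (U : Set X) (e : ↥U ≃ₜ ↥(Metric.sphere (0 : ℂ) 1) × ↥(Set.Ioo (-1 : ℝ) 1))
    (he : ∀ x : ↥U, (x : X) ∈ cycleImage f p c hcyc ↔ ((e x).2 : ℝ) = 0)
    (hCU : cycleImage f p c hcyc ⊆ U)
    (hs : ∀ (i : ZMod p) (w : V) (hw : w ∉ Set.range c) (h : G.Adj (c i) w),
        ∃ ε > (0 : ℝ), ∀ t : ↥(Set.Icc (0 : ℝ) 1), 0 < (t : ℝ) → (t : ℝ) < ε →
          ∃ hm : f.arc (c i) w h t ∈ U,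
            (0 < ((e ⟨f.arc (c i) w h t, hm⟩).2 : ℝ) ↔ side i w = true))
    (u v : V) (h : G.Adj u v) (hu : u ∉ Set.range c) :
    ∃ D : Set X, IsClosed D ∧ Disjoint D (cycleImage f p c hcyc) ∧
      ∀ x ∈ Set.range (f.arc u v h), x ∈ D ∨ ∃ i, v = c i ∧
        (side i u = false → heightFn U e x ≤ 0) ∧ (side i u = true → 0 ≤ heightFn U e x) := by
  by_cases hv : v ∈ Set.range c
  · obtain ⟨i, rfl⟩ := hv
    obtain ⟨ε, hε, hs⟩ := hs i u hu h.symm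
    refine ⟨f.arc (c i) u h.symm '' {t | ε ≤ (t : ℝ)}, ?_, ?_, ?_⟩
    · apply IsCompact.isClosed
      apply IsCompact.image _ (f.arc (c i) u h.symm).continuous
      apply IsClosed.isCompact
      exact isClosed_le continuous_const continuous_subtype_val
    · rw [Set.disjoint_left]
      rintro _ ⟨t, ht, rfl⟩ hC
      obtain ⟨w, hw, hw', hx⟩ := arc_inter_cycle f hcyc (c i) u h.symm (Or.inr hu) _ ⟨t, rfl⟩ hC
      rcases hw' with rfl | rfl
      · rw [← f.arc_zero _ _ h.symm] at hx
        have := f.arc_inj _ _ _ hx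
        rw [this] at ht
        simp only [Set.mem_setOf_eq] at ht
        linarith
      · exact hu hw
    · intro x hx
      rw [← f.arc_symm] at hx
      obtain ⟨t, rfl⟩ := hx
      by_cases ht : ε ≤ (t : ℝ)
      · exact Or.inl ⟨t, ht, rfl⟩
      · refine Or.inr ⟨i, rfl, ?_⟩
        push Not at ht
        rcases t.2.1.lt_or_eq with h0 | h0
        · obtain ⟨hm, hiff⟩ := hs t h0 ht
          have hh := heightFn_mem U e ⟨_, hm⟩
          simp only at hh
          rw [hh]
          constructor
          · intro h1
            by_contra h2
            push Not at h2
            simp [hiff.1 h2] at h1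
          · intro h1
            exact (hiff.2 h1).le
        · have ht0 : t = ⟨0, by norm_num⟩ := Subtype.ext h0.symm
          have hmem : f.arc (c i) u h.symm t ∈ cycleImage f p c hcyc := by
            rw [ht0, f.arc_zero]
            exact vmap_mem_cycle f hcyc _ ⟨i, rfl⟩
          have h1 := (he ⟨_, hCU hmem⟩).1 hmem
          rw [← heightFn_mem] at h1
          simp only at h1
          rw [h1]
          simp
  · refine ⟨Set.range (f.arc u v h), ?_, ?_, fun x hx => Or.inl hx⟩
    · exact (isCompact_range (f.arc u v h).continuous).isClosed
    · rw [Set.disjoint_left]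
      intro x hx hC
      obtain ⟨w, hw, rfl | rfl, -⟩ := arc_inter_cycle f hcyc u v h (Or.inl hu) _ hx hC
      · exact hu hw
      · exact hv hw

/-- The part of the skeleton spanned by a set of outer vertices. -/
def partSkel (f : GraphEmbedding G X) (A : Set V) : Set X :=
  ⋃ (u : V) (_ : u ∈ A), ({f.vmap u} ∪ ⋃ (v : V) (h : G.Adj u v), Set.range (f.arc u v h))

lemma partSkel_closed [Finite V] [T2Space X] (f : GraphEmbedding G X) (A : Set V) :
    IsClosed (partSkel f A) := by
  refine isClosed_iUnion_of_finite fun u => isClosed_iUnion_of_finite fun _ =>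
    isClosed_singleton.union (isClosed_iUnion_of_finite fun v => isClosed_iUnion_of_finite fun h => ?_)
  exact (isCompact_range (f.arc u v h).continuous).isClosed

lemma mem_partSkel (f : GraphEmbedding G X) (A : Set V) (x : X) :
    x ∈ partSkel f A ↔ ∃ u ∈ A, x = f.vmap u ∨ ∃ v, ∃ h : G.Adj u v, x ∈ Set.range (f.arc u v h) := by
  simp only [partSkel, Set.mem_iUnion, Set.mem_union, Set.mem_singleton_iff, exists_prop]

end graphpart

/-- **Duplicating a non-separating cycle preserves connectivity.** Let `G` be a connected
graph with a 2-cell embedding `f` on a closed surface `X`, and let `C = (c 0, …, c (p-1))`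
be a simple (induced, orientable) cycle of `G` that is non-separating: `X ∖ C` is
connected. Then the graph `G_C` obtained by duplicating `C` — replacing each vertex `c i`
by a left and a right copy, duplicating the cycle edges on each side, and attaching each
edge from the cycle to the outside to the copy on its side — is connected. -/
theorem cycleDup_connected {V : Type} [Finite V] (G : SimpleGraph V) (hG : G.Connected)
    (X : Type) [TopologicalSpace X] (hX : IsClosedSurface X)
    (f : GraphEmbedding G X) (h2 : f.IsTwoCell)
    (p : ℕ) (hp : 3 ≤ p) (c : ZMod p → V) (hc : Function.Injective c)
    (hcyc : ∀ i : ZMod p, G.Adj (c i) (c (i + 1)))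
    (hind : ∀ i j : ZMod p, G.Adj (c i) (c j) → j = i + 1 ∨ i = j + 1)
    (hnonsep : IsConnected (cycleImage f p c hcyc)ᶜ)
    (side : ZMod p → V → Bool)
    (hside : SideCompatible f p c hcyc side) :
    (cycleDup G p c side).Connected := by
  by_contra hnc
  have hnr : ¬ (cycleDup G p c side).Reachable (Sum.inr (0, false)) (Sum.inr (0, true)) :=
    fun h => hnc (dup_conn hp hG h)
  haveI : NeZero p := ⟨by omega⟩
  haveI := locConn hX
  obtain ⟨hX1, hX2, hX3, -⟩ := hX
  obtain ⟨U, hU, hCU, e, he, hs⟩ := hside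
  let R : Set ({v : V // v ∉ Set.range c} ⊕ (ZMod p × Bool)) :=
    {x | (cycleDup G p c side).Reachable (Sum.inr (0, false)) x}
  have hRadj : ∀ x y, (cycleDup G p c side).Adj x y → (x ∈ R ↔ y ∈ R) := fun x y h =>
    ⟨fun hx => hx.trans h.reachable, fun hy => hy.trans h.symm.reachable⟩
  have hRf : ∀ i, (Sum.inr (i, false)) ∈ R := fun i => dup_cyc_reach hp i false
  have hRt : ∀ i, (Sum.inr (i, true)) ∉ R := fun i hi =>
    hnr (hi.trans (dup_cyc_reach hp i true).symm)
  let A : Set V := {u | ∃ hu : u ∉ Set.range c, Sum.inl ⟨u, hu⟩ ∈ R}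
  let B : Set V := {u | ∃ hu : u ∉ Set.range c, Sum.inl ⟨u, hu⟩ ∉ R}
  have hAB : ∀ u, u ∈ A → u ∈ B → False := fun u ⟨_, h1⟩ ⟨_, h2⟩ => h2 h1
  have hAadj : ∀ u v, G.Adj u v → v ∉ Set.range c → u ∈ A → v ∈ A := fun u v h hv ⟨hu, hR⟩ =>
    ⟨hv, (hRadj _ _ (dup_out u v hu hv h)).1 hR⟩
  have hBadj : ∀ u v, G.Adj u v → v ∉ Set.range c → u ∈ B → v ∈ B := fun u v h hv ⟨hu, hR⟩ =>
    ⟨hv, fun h' => hR ((hRadj _ _ (dup_out u v hu hv h)).2 h')⟩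
  have hor : ∀ u, u ∉ Set.range c → u ∈ A ∨ u ∈ B := fun u hu => by
    by_cases h : Sum.inl ⟨u, hu⟩ ∈ R
    · exact Or.inl ⟨hu, h⟩
    · exact Or.inr ⟨hu, h⟩
  -- vertices covered by a part
  have hvert : ∀ (P : Set V), (∀ u v, G.Adj u v → v ∉ Set.range c → u ∈ P → v ∈ P) →
      ∀ w, w ∉ Set.range c → f.vmap w ∈ partSkel f P → w ∈ P := by
    intro P hP w hw hx
    obtain ⟨u, hu, h1 | ⟨v, h, h1⟩⟩ := (mem_partSkel f P _).1 hx
    · rwa [f.vmap_inj h1]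
    · rcases f.arc_vertex _ _ h w h1 with rfl | rfl
      · exact hu
      · exact hP _ _ h hw hu
  choose D hDcl hDC hD using fun (u v : V) (h : G.Adj u v) (hu : u ∉ Set.range c) =>
    arc_piece (side := side) f hcyc U e he hCU hs u v h hu
  let DD : Set X := (f.vmap '' (Set.range c)ᶜ) ∪
    ⋃ (u : V) (v : V) (h : G.Adj u v) (hu : u ∉ Set.range c), D u v h hu
  have hDDcl : IsClosed DD := by
    refine IsClosed.union (Set.toFinite _).isClosed ?_
    exact isClosed_iUnion_of_finite fun u => isClosed_iUnion_of_finite fun v =>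
      isClosed_iUnion_of_finite fun h => isClosed_iUnion_of_finite fun hu => hDcl u v h hu
  have hDDC : Disjoint DD (cycleImage f p c hcyc) := by
    rw [Set.disjoint_left]
    rintro x (⟨w, hw, rfl⟩ | hx) hC
    · obtain ⟨i, hi⟩ := Set.mem_iUnion.1 hC
      rcases f.arc_vertex _ _ _ w hi with rfl | rfl <;> simp at hw
    · simp only [Set.mem_iUnion] at hx
      obtain ⟨u, v, h, hu, hx⟩ := hx
      exact Set.disjoint_left.1 (hDC u v h hu) hx hC
  have hDDm : ∀ u v h hu x, x ∈ D u v h hu → x ∈ DD := by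
    intro u v h hu x hx
    right
    simp only [Set.mem_iUnion]
    exact ⟨u, v, h, hu, hx⟩
  refine height_core f.skeleton (cycleImage f p c hcyc) (partSkel f A) (partSkel f B)
    (heightFn U e) h2 ?_ (partSkel_closed f A) (partSkel_closed f B) ?_ ?_
    (fun a b _ hb => heightFn_open U hU e a b hb) (fun a b => heightFn_closed U e a b)
    ?_ ?_ hnonsep.isPreconnected DD DD hDDcl hDDcl hDDC hDDC ?_ ?_
  · ext x
    constructor
    · rintro (⟨w, rfl⟩ | hx)
      · by_cases hw : w ∈ Set.range c
        · exact Or.inl (Or.inl (vmap_mem_cycle f hcyc w hw))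
        · rcases hor w hw with h | h
          · exact Or.inl (Or.inr ((mem_partSkel f A _).2 ⟨w, h, Or.inl rfl⟩))
          · exact Or.inr ((mem_partSkel f B _).2 ⟨w, h, Or.inl rfl⟩)
      · simp only [Set.mem_iUnion] at hx
        obtain ⟨u, v, h, hx⟩ := hx
        by_cases hu : u ∈ Set.range c
        · by_cases hv : v ∈ Set.range c
          · left; left
            obtain ⟨i, rfl⟩ := hu
            obtain ⟨j, rfl⟩ := hv
            rcases hind i j h with rfl | rfl
            · exact Set.mem_iUnion.2 ⟨i, hx⟩
            · rw [← f.arc_symm] at hx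
              exact Set.mem_iUnion.2 ⟨j, hx⟩
          · rw [← f.arc_symm] at hx
            rcases hor v hv with h' | h'
            · exact Or.inl (Or.inr ((mem_partSkel f A _).2 ⟨v, h', Or.inr ⟨u, h.symm, hx⟩⟩))
            · exact Or.inr ((mem_partSkel f B _).2 ⟨v, h', Or.inr ⟨u, h.symm, hx⟩⟩)
        · rcases hor u hu with h' | h'
          · exact Or.inl (Or.inr ((mem_partSkel f A _).2 ⟨u, h', Or.inr ⟨v, h, hx⟩⟩))
          · exact Or.inr ((mem_partSkel f B _).2 ⟨u, h', Or.inr ⟨v, h, hx⟩⟩)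
    · have hpart : ∀ P, partSkel f P ⊆ f.skeleton := by
        intro P x hx
        obtain ⟨u, hu, rfl | ⟨v, h, h1⟩⟩ := (mem_partSkel f P _).1 hx
        · exact Or.inl ⟨u, rfl⟩
        · right
          simp only [Set.mem_iUnion]
          exact ⟨u, v, h, h1⟩
      rintro ((hx | hx) | hx)
      · obtain ⟨i, hi⟩ := Set.mem_iUnion.1 hx
        right
        simp only [Set.mem_iUnion]
        exact ⟨_, _, _, hi⟩
      · exact hpart A hx
      · exact hpart B hx
  · rintro x ⟨hxA, hxB⟩
    by_contra hxC
    have hnv : ∀ w, x ≠ f.vmap w := by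
      rintro w rfl
      by_cases hw : w ∈ Set.range c
      · exact hxC (vmap_mem_cycle f hcyc w hw)
      · exact hAB w (hvert A hAadj w hw hxA) (hvert B hBadj w hw hxB)
    obtain ⟨u, hu, h1 | ⟨v, h, h1⟩⟩ := (mem_partSkel f A _).1 hxA
    · exact hnv _ h1
    obtain ⟨u', hu', h1' | ⟨v', h', h1'⟩⟩ := (mem_partSkel f B _).1 hxB
    · exact hnv _ h1'
    by_cases hee : s(u, v) = s(u', v')
    · rw [Sym2.eq_iff] at hee
      rcases hee with ⟨rfl, rfl⟩ | ⟨rfl, rfl⟩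
      · exact hAB _ hu hu'
      · exact hAB _ (hAadj _ _ h hu'.1 hu) hu'
    · obtain ⟨w, hw⟩ := f.arc_disjoint _ _ h _ _ h' hee ⟨h1, h1'⟩
      exact hnv w hw.symm
  · intro x
    by_cases hx : x ∈ U
    · rw [he ⟨x, hx⟩, ← heightFn_mem U e]
    · constructor
      · intro h; exact absurd (hCU h) hx
      · intro h; simp [heightFn, hx] at h
  · intro δ h0 h1
    exact heightFn_fiber U e _ isPreconnected_Ioc
      fun x hx => ⟨by linarith [hx.1], by linarith [hx.2]⟩
  · intro δ h0 h1
    exact heightFn_fiber U e _ isPreconnected_Ico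
      fun x hx => ⟨by linarith [hx.1], by linarith [hx.2]⟩
  · intro x hx
    obtain ⟨u, ⟨hu, huR⟩, rfl | ⟨v, h, h1⟩⟩ := (mem_partSkel f A _).1 hx
    · exact Or.inl (Or.inl ⟨u, hu, rfl⟩)
    · rcases hD u v h hu x h1 with h3 | ⟨i, rfl, h3, -⟩
      · exact Or.inl (hDDm _ _ _ _ _ h3)
      · refine Or.inr (h3 ?_)
        by_contra h4
        have h5 := (hRadj _ _ (dup_side (side := side) i u hu h.symm)).2 huR
        rw [Bool.not_eq_false] at h4
        rw [h4] at h5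
        exact hRt i h5
  · intro x hx
    obtain ⟨u, ⟨hu, huR⟩, rfl | ⟨v, h, h1⟩⟩ := (mem_partSkel f B _).1 hx
    · exact Or.inl (Or.inl ⟨u, hu, rfl⟩)
    · rcases hD u v h hu x h1 with h3 | ⟨i, rfl, -, h3⟩
      · exact Or.inl (hDDm _ _ _ _ _ h3)
      · refine Or.inr (h3 ?_)
        by_contra h4
        rw [Bool.not_eq_true] at h4
        refine huR ((hRadj _ _ (dup_side (side := side) i u hu h.symm)).1 ?_)
        rw [h4]
        exact hRf i
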